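/- Let φ : ℂ → ℙ¹ be a nonconstant meromorphic function and suppose there is a finite set A ⊆ ℙ¹ with |A| ≥ 5 such that the derivative of φ vanishes at every point t ∈ ℂ with φ(t) ∈ A. Then no such φ exists; i.e., every meromorphic φ : ℂ → ℙ¹ whose derivative vanishes on the preimage of 5 given points is constant. -/

import Mathlib

open Filter Topology Complex

/-- Second-order Taylor expansion with a continuous remainder factor. -/
theorem AnalyticAt.exists_eq_add_add_sq_mul {f : ℂ → ℂ} (hf : AnalyticAt ℂ f 0) :
    ∃ n : ℂ → ℂ, ContinuousAt n 0 ∧ ∀ t, f t = f 0 + deriv f 0 * t + t ^ 2 * n t := by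
  have dslope_analytic {u : ℂ → ℂ} (hu : AnalyticAt ℂ u 0) : AnalyticAt ℂ (dslope u 0) 0 := by
    obtain ⟨p, hp⟩ := hu
    exact ⟨_, hp.has_fpower_series_dslope_fslope⟩
  refine ⟨dslope (dslope f 0) 0, (dslope_analytic (dslope_analytic hf)).continuousAt, fun t => ?_⟩
  have h1 := sub_smul_dslope f 0 t
  have h2 := sub_smul_dslope (dslope f 0) 0 t
  simp only [sub_zero, smul_eq_mul, dslope_same] at h1 h2
  linear_combination -h1 - t * h2

/-- The sum of `‖f‖²` over the four points `r, ir, -r, -ir` is bounded below by the contribution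
of the first-order Taylor polynomial, up to `o(r²)`. -/
theorem AnalyticAt.exists_sum_normSq_lower_bound {f : ℂ → ℂ} (hf : AnalyticAt ℂ f 0) :
    ∃ E : ℝ → ℝ, Tendsto E (𝓝[>] 0) (𝓝 0) ∧ ∀ r : ℝ,
      4 * ‖f 0‖ ^ 2 + r ^ 2 * (4 * ‖deriv f 0‖ ^ 2 + E r) ≤
        ∑ k : Fin 4, ‖f (I ^ (k : ℕ) * r)‖ ^ 2 := by
  obtain ⟨n, hn, hfn⟩ := hf.exists_eq_add_add_sq_mul
  set A := f 0
  set B := deriv f 0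
  refine ⟨fun r => ∑ k : Fin 4, 2 * ((starRingEnd ℂ) (A + B * (I ^ (k : ℕ) * r)) *
    ((I ^ (k : ℕ)) ^ 2 * n (I ^ (k : ℕ) * r))).re, ?_, fun r => ?_⟩
  · have key : ∀ k : Fin 4, Tendsto (fun r : ℝ => 2 * ((starRingEnd ℂ) (A + B * (I ^ (k : ℕ) * r)) *
        ((I ^ (k : ℕ)) ^ 2 * n (I ^ (k : ℕ) * r))).re) (𝓝[>] 0)
        (𝓝 (2 * ((starRingEnd ℂ) A * ((I ^ (k : ℕ)) ^ 2 * n 0)).re)) := by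
      intro k
      have hc : ContinuousAt (fun r : ℝ => n (I ^ (k : ℕ) * r)) 0 :=
        ContinuousAt.comp (f := fun r : ℝ => I ^ (k : ℕ) * (r : ℂ)) (by simpa using hn)
          (by fun_prop)
      have hc' : ContinuousAt (fun r : ℝ => 2 * ((starRingEnd ℂ) (A + B * (I ^ (k : ℕ) * r)) *
        ((I ^ (k : ℕ)) ^ 2 * n (I ^ (k : ℕ) * r))).re) 0 := by
        have : ContinuousAt (fun r : ℝ => ((starRingEnd ℂ) (A + B * (I ^ (k : ℕ) * r)) *
          ((I ^ (k : ℕ)) ^ 2 * n (I ^ (k : ℕ) * r)))) 0 :=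
          ContinuousAt.mul (continuous_conj.continuousAt.comp (by fun_prop)) (hc.const_mul _)
        exact continuousAt_const.mul (continuous_re.continuousAt.comp this)
      have := hc'.tendsto.mono_left (nhdsWithin_le_nhds (s := Set.Ioi 0))
      simpa using this
    have := tendsto_finsetSum (Finset.univ : Finset (Fin 4)) (fun k _ => key k)
    convert this using 2
    simp [Fin.sum_univ_four, pow_succ]
    ring
  · have step : ∀ t s : ℂ, ‖A + B * t‖ ^ 2 + 2 * ((starRingEnd ℂ) (A + B * t) * (t ^ 2 * s)).re ≤
        ‖A + B * t + t ^ 2 * s‖ ^ 2 := by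
      intro t s
      rw [← normSq_eq_norm_sq, ← normSq_eq_norm_sq, normSq_add (A + B * t)]
      have := normSq_nonneg (t ^ 2 * s)
      have h2 : (A + B * t) * (starRingEnd ℂ) (t ^ 2 * s) =
        (starRingEnd ℂ) ((starRingEnd ℂ) (A + B * t) * (t ^ 2 * s)) := by simp
      rw [h2, conj_re]; linarith
    have := Finset.sum_le_sum (fun (k : Fin 4) (_ : k ∈ Finset.univ) =>
      step (I ^ (k : ℕ) * r) (n (I ^ (k : ℕ) * r)))
    simp only [← hfn] at this
    refine le_trans (le_of_eq ?_) this
    rw [Finset.sum_add_distrib, mul_add, Finset.mul_sum, ← add_assoc]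
    congr 1
    · simp only [← normSq_eq_norm_sq, Fin.sum_univ_four, normSq_apply]
      simp [pow_succ]
      ring
    · refine Finset.sum_congr rfl fun k _ => ?_
      rw [show (starRingEnd ℂ) (A + B * (I ^ (k : ℕ) * r)) *
        ((I ^ (k : ℕ) * r) ^ 2 * n (I ^ (k : ℕ) * r)) = ((r ^ 2 : ℝ) : ℂ) *
        ((starRingEnd ℂ) (A + B * (I ^ (k : ℕ) * r)) *
        ((I ^ (k : ℕ)) ^ 2 * n (I ^ (k : ℕ) * r))) by push_cast; ring, re_ofReal_mul]
      ring

/-- A nonvanishing analytic function has a local analytic square root. -/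
theorem AnalyticAt.exists_sq_eq {f : ℂ → ℂ} {z : ℂ} (hf : AnalyticAt ℂ f z) (h0 : f z ≠ 0) :
    ∃ s : ℂ → ℂ, AnalyticAt ℂ s z ∧ ∀ᶠ w in 𝓝 z, s w ^ 2 = f w := by
  obtain ⟨c, hc⟩ := IsAlgClosed.exists_pow_nat_eq (f z) two_pos
  have hq : AnalyticAt ℂ (fun w => f w / f z) z := hf.div_const
  have hs : (fun w => f w / f z) z ∈ slitPlane := by simp [h0]
  refine ⟨fun w => c * Complex.exp (Complex.log (f w / f z) / 2), ?_, ?_⟩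
  · exact analyticAt_const.mul (AnalyticAt.cexp (AnalyticAt.div_const (hq.clog hs)))
  · have : ∀ᶠ w in 𝓝 z, f w ≠ 0 := hf.continuousAt.eventually_ne h0
    filter_upwards [this] with w hw
    rw [mul_pow, ← exp_nat_mul, hc]
    push_cast
    rw [mul_div_cancel₀ _ two_ne_zero, exp_log (div_ne_zero hw h0)]
    field_simp

/-- An entire function `P` vanishing everywhere to at least the order of `Q` is divisible by `Q`. -/
theorem Differentiable.exists_mul_eq_of_analyticOrderAt_le {P Q : ℂ → ℂ}
    (hP : Differentiable ℂ P) (hQ : Differentiable ℂ Q) (htop : ∀ z, analyticOrderAt Q z ≠ ⊤)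
    (hle : ∀ z, analyticOrderAt Q z ≤ analyticOrderAt P z) :
    ∃ F : ℂ → ℂ, (∀ z, AnalyticAt ℂ F z) ∧ ∀ z, F z * Q z = P z := by
  have hPa (z) : AnalyticAt ℂ P z := hP.analyticAt z
  have hQa (z) : AnalyticAt ℂ Q z := hQ.analyticAt z
  have hm : MeromorphicOn (P / Q) Set.univ := fun z _ =>
    (hPa z).meromorphicAt.div (hQa z).meromorphicAt
  have hF (z) : AnalyticAt ℂ (toMeromorphicNFOn (P / Q) Set.univ) z := by
    rw [← (meromorphicNFOn_toMeromorphicNFOn (P / Q) Set.univ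
      (Set.mem_univ z)).meromorphicOrderAt_nonneg_iff_analyticAt,
      meromorphicOrderAt_toMeromorphicNFOn hm (Set.mem_univ z),
      meromorphicOrderAt_div (hPa z).meromorphicAt (hQa z).meromorphicAt,
      (hPa z).meromorphicOrderAt_eq, (hQa z).meromorphicOrderAt_eq]
    have h1 := htop z
    have h2 := hle z
    generalize analyticOrderAt Q z = a at *
    generalize analyticOrderAt P z = b at *
    lift a to ℕ using h1
    induction b using ENat.recTopCoe with
    | top => simp
    | coe b =>
      have hab : (a : ℤ) ≤ b := by exact_mod_cast h2
      simp only [ENat.map_natCast]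
      exact WithTop.coe_le_coe.2 (sub_nonneg.2 hab)
  refine ⟨_, hF, fun z => ?_⟩
  have hev : (fun w => toMeromorphicNFOn (P / Q) Set.univ w * Q w) =ᶠ[𝓝[≠] z] P := by
    have hQne : ∀ᶠ w in 𝓝[≠] z, Q w ≠ 0 :=
      (hQa z).eventually_eq_zero_or_eventually_ne_zero.resolve_left
        (fun h => htop z (analyticOrderAt_eq_top.2 h))
    filter_upwards [hm.toMeromorphicNFOn_eq_self_on_nhdsNE (Set.mem_univ z), hQne] with w hw hq
    simp [hw, hq]
  exact (((((hF z).mul (hQa z)).continuousAt).eventuallyEq_nhds_iff_eventuallyEq_nhdsNE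
    (hPa z).continuousAt).1 hev).eq_of_nhds

/-- At a zero of `f` where `X` does not vanish, the Wronskian of `f` and `X` vanishes to order
one less than `f`. -/
theorem AnalyticAt.analyticOrderAt_wronskian_add_one {f X : ℂ → ℂ} {z : ℂ}
    (hf : AnalyticAt ℂ f z) (hX : AnalyticAt ℂ X z) (hfz : f z = 0) (hXz : X z ≠ 0) :
    analyticOrderAt (fun w => deriv f w * X w - f w * deriv X w) z + 1 =
      analyticOrderAt f z := by
  have hq : AnalyticAt ℂ (f / X) z := hf.div hX hXz
  have h1 := hq.analyticOrderAt_deriv_add_one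
  have h0 : (f / X) z = 0 := by simp [hfz]
  rw [h0] at h1
  simp only [sub_zero] at h1
  have hXne : ∀ᶠ w in 𝓝 z, X w ≠ 0 := hX.continuousAt.eventually_ne hXz
  have ho {Y : ℂ → ℂ} (hY : AnalyticAt ℂ Y z) (hYz : Y z ≠ 0) : analyticOrderAt Y z = 0 :=
    hY.analyticOrderAt_eq_zero.2 hYz
  have h2 : analyticOrderAt f z = analyticOrderAt (f / X) z := by
    rw [← add_zero (analyticOrderAt (f / X) z), ← ho hX hXz, ← analyticOrderAt_mul hq hX]
    refine analyticOrderAt_congr ?_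
    filter_upwards [hXne] with w hw
    simp [hw]
  have h3 : analyticOrderAt (fun w => deriv f w * X w - f w * deriv X w) z =
      analyticOrderAt (deriv (f / X)) z := by
    rw [← add_zero (analyticOrderAt (deriv (f / X)) z), ← ho (hX.pow 2) (pow_ne_zero 2 hXz),
      ← analyticOrderAt_mul hq.deriv (hX.pow 2)]
    refine analyticOrderAt_congr ?_
    filter_upwards [hXne, hf.eventually_analyticAt, hX.eventually_analyticAt] with w hw hfw hXw
    simp only [Pi.mul_apply, Pi.pow_apply]
    rw [deriv_div hfw.differentiableAt hXw.differentiableAt hw]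
    field_simp
  rw [h2, h3, h1]

/-- Infinitesimal form of the Ahlfors–Schwarz lemma: if `∑ ‖mᵢ‖² · (R² - ‖z - p‖²)²` has a local
maximum at `z₀`, then the pairwise Wronskians of the `mᵢ` at `z₀` are controlled. -/
theorem IsLocalMax.norm_wronskian_sq_le {ι : Type*} [Fintype ι] {m : ι → ℂ → ℂ} {p z₀ : ℂ} {R : ℝ}
    (hm : ∀ i, AnalyticAt ℂ (m i) z₀) (hD : 0 < R ^ 2 - ‖z₀ - p‖ ^ 2)
    (hmax : IsLocalMax (fun z => (∑ i, ‖m i z‖ ^ 2) * (R ^ 2 - ‖z - p‖ ^ 2) ^ 2) z₀)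
    {i j : ι} (hij : i ≠ j) :
    ‖deriv (m i) z₀ * m j z₀ - m i z₀ * deriv (m j) z₀‖ ^ 2 * (R ^ 2 - ‖z₀ - p‖ ^ 2) ^ 2 ≤
      2 * R ^ 2 * (∑ i, ‖m i z₀‖ ^ 2) ^ 2 := by
  set D : ℝ := R ^ 2 - ‖z₀ - p‖ ^ 2 with hDdef
  set β : ℂ := (starRingEnd ℂ) (z₀ - p) / D with hβ
  set κ : ℝ := R ^ 2 / D ^ 2 with hκ
  set A : ℝ := ∑ i, ‖m i z₀‖ ^ 2 with hA
  have hDc : (D : ℂ) ≠ 0 := by exact_mod_cast hD.ne'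
  have hdist (t : ℂ) : R ^ 2 - ‖z₀ + t - p‖ ^ 2 = D * (‖1 - β * t‖ ^ 2 - κ * ‖t‖ ^ 2) := by
    have h1 : R ^ 2 = D + ‖z₀ - p‖ ^ 2 := by rw [hDdef]; ring
    rw [hκ, h1, hβ, add_sub_right_comm z₀ t p]
    generalize z₀ - p = w at *
    simp only [← normSq_eq_norm_sq, normSq_apply]
    have e : (1 - (starRingEnd ℂ) w / (D : ℂ) * t) =
        ⟨1 - (w.re * t.re + w.im * t.im) / D, -(w.re * t.im - w.im * t.re) / D⟩ := by
      apply Complex.ext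
      · simp [← ofReal_inv, div_eq_mul_inv]; ring
      · simp [← ofReal_inv, div_eq_mul_inv]; ring
    rw [e]
    simp only [add_re, add_im]
    field_simp
    ring
  set M : ι → ℂ → ℂ := fun i t => m i (z₀ + t) * (1 - β * t) ^ 2 with hM
  have hma (i) : AnalyticAt ℂ (fun t => m i (z₀ + t)) 0 :=
    AnalyticAt.fun_comp (g := m i) (f := fun t => z₀ + t) (by simpa using hm i) (by fun_prop)
  have hMa (i) : AnalyticAt ℂ (M i) 0 := (hma i).mul (by fun_prop)
  have hM0 (i) : M i 0 = m i z₀ := by simp [hM]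
  have hM' (i) : deriv (M i) 0 = deriv (m i) z₀ - 2 * β * m i z₀ := by
    have h1 : HasDerivAt (fun t => m i (z₀ + t)) (deriv (m i) z₀) 0 := by
      have := (hm i).differentiableAt.hasDerivAt
      exact HasDerivAt.comp_const_add z₀ 0 (by simpa using this)
    have h2 : HasDerivAt (fun t : ℂ => (1 - β * t) ^ 2) (-2 * β) 0 := by
      have := (((hasDerivAt_id (0 : ℂ)).const_mul β).const_sub 1).fun_pow 2
      refine this.congr_deriv ?_
      simp
    rw [(h1.fun_mul h2).deriv]
    simp
    ring
  choose E hE0 hE using fun i => (hMa i).exists_sum_normSq_lower_bound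
  simp only [hM0, hM'] at hE
  set B : ι → ℂ := fun i => deriv (m i) z₀ - 2 * β * m i z₀ with hB
  have hpt : ∀ᶠ t in 𝓝 (0 : ℂ), ∑ i, ‖M i t‖ ^ 2 ≤
      A + 2 * κ * ‖t‖ ^ 2 * ∑ i, ‖m i (z₀ + t) * (1 - β * t)‖ ^ 2 := by
    have hcont : Tendsto (fun t : ℂ => z₀ + t) (𝓝 0) (𝓝 z₀) := by
      have : ContinuousAt (fun t : ℂ => z₀ + t) 0 := by fun_prop
      simpa using this.tendsto
    filter_upwards [hcont.eventually hmax] with t ht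
    simp only [hdist] at ht
    rw [← hDdef, ← hA] at ht
    have h1 : (∑ i, ‖m i (z₀ + t)‖ ^ 2) * (‖1 - β * t‖ ^ 2 - κ * ‖t‖ ^ 2) ^ 2 ≤ A := by
      refine le_of_mul_le_mul_right ?_ (pow_pos hD 2)
      linarith
    have h2 : ∑ i, ‖M i t‖ ^ 2 = (∑ i, ‖m i (z₀ + t)‖ ^ 2) * ‖1 - β * t‖ ^ 4 := by
      rw [Finset.sum_mul]
      exact Finset.sum_congr rfl fun i _ => by simp only [hM, norm_mul, norm_pow]; ring
    have h3 : ∑ i, ‖m i (z₀ + t) * (1 - β * t)‖ ^ 2 =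
        (∑ i, ‖m i (z₀ + t)‖ ^ 2) * ‖1 - β * t‖ ^ 2 := by
      rw [Finset.sum_mul]
      exact Finset.sum_congr rfl fun i _ => by simp only [norm_mul]; ring
    rw [h2, h3]
    have hS : 0 ≤ ∑ i, ‖m i (z₀ + t)‖ ^ 2 := by positivity
    nlinarith [mul_nonneg hS (sq_nonneg (κ * ‖t‖ ^ 2))]
  have hlim : 4 * ∑ i, ‖B i‖ ^ 2 ≤ 8 * κ * A := by
    have hIr (k : Fin 4) : Tendsto (fun r : ℝ => I ^ (k : ℕ) * (r : ℂ)) (𝓝[>] 0) (𝓝 0) := by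
      have : ContinuousAt (fun r : ℝ => I ^ (k : ℕ) * (r : ℂ)) 0 := by fun_prop
      simpa using this.tendsto.mono_left (nhdsWithin_le_nhds (s := Set.Ioi 0))
    have hL : Tendsto (fun r : ℝ => ∑ i, (4 * ‖B i‖ ^ 2 + E i r)) (𝓝[>] 0)
        (𝓝 (∑ i, (4 * ‖B i‖ ^ 2 + 0))) :=
      tendsto_finsetSum _ fun i _ => (hE0 i).const_add _
    have hRk (k : Fin 4) : Tendsto (fun r : ℝ => ∑ i, ‖m i (z₀ + I ^ (k : ℕ) * r) *
        (1 - β * (I ^ (k : ℕ) * r))‖ ^ 2) (𝓝[>] 0) (𝓝 A) := by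
      have hc : ContinuousAt (fun t : ℂ => ∑ i, ‖m i (z₀ + t) * (1 - β * t)‖ ^ 2) 0 :=
        tendsto_finsetSum _ fun i _ =>
          (((hma i).continuousAt.mul (by fun_prop : ContinuousAt (fun t => 1 - β * t) 0)).norm.pow 2)
      have := hc.tendsto.comp (hIr k)
      simpa [hA, Function.comp_def] using this
    have hR : Tendsto (fun r : ℝ => 2 * κ * ∑ k : Fin 4, ∑ i, ‖m i (z₀ + I ^ (k : ℕ) * r) *
        (1 - β * (I ^ (k : ℕ) * r))‖ ^ 2) (𝓝[>] 0) (𝓝 (2 * κ * ∑ k : Fin 4, A)) :=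
      (tendsto_finsetSum _ fun k _ => hRk k).const_mul _
    have hle := le_of_tendsto_of_tendsto hL hR ?_
    · simp only [add_zero, ← Finset.mul_sum] at hle
      simp at hle
      linarith
    · have hev : ∀ᶠ r : ℝ in 𝓝[>] 0, ∀ k : Fin 4, ∑ i, ‖M i (I ^ (k : ℕ) * r)‖ ^ 2 ≤
          A + 2 * κ * ‖I ^ (k : ℕ) * (r : ℂ)‖ ^ 2 *
            ∑ i, ‖m i (z₀ + I ^ (k : ℕ) * r) * (1 - β * (I ^ (k : ℕ) * r))‖ ^ 2 :=
        eventually_all.2 fun k => (hIr k).eventually hpt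
      filter_upwards [hev, self_mem_nhdsWithin] with r hr hr0
      have hr0 : 0 < r := hr0
      have h1 := Finset.sum_le_sum (fun (k : Fin 4) (_ : k ∈ Finset.univ) => hr k)
      have h2 := Finset.sum_le_sum (fun i (_ : i ∈ Finset.univ) => hE i r)
      rw [Finset.sum_comm] at h2
      have h3 := h2.trans h1
      simp only [norm_mul, norm_pow, norm_I, one_pow, one_mul, norm_real, Real.norm_eq_abs, sq_abs,
        Finset.sum_add_distrib, ← Finset.mul_sum, Finset.sum_const, Finset.card_univ,
        Fintype.card_fin, nsmul_eq_mul] at h3 ⊢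
      refine le_of_mul_le_mul_left ?_ (pow_pos hr0 2)
      simp only [← hA] at h3
      push_cast at h3
      linarith
  have hwr : deriv (m i) z₀ * m j z₀ - m i z₀ * deriv (m j) z₀ = B i * m j z₀ - m i z₀ * B j := by
    simp only [hB]; ring
  have hpair (a : ι → ℂ) : ‖a i‖ ^ 2 + ‖a j‖ ^ 2 ≤ ∑ i, ‖a i‖ ^ 2 := by
    classical
    rw [← Finset.sum_pair (f := fun i => ‖a i‖ ^ 2) hij]
    exact Finset.sum_le_sum_of_subset_of_nonneg (Finset.subset_univ _) fun _ _ _ => sq_nonneg _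
  have hcs : ‖B i * m j z₀ - m i z₀ * B j‖ ^ 2 ≤ (∑ i, ‖B i‖ ^ 2) * A := by
    have h1 : ‖B i * m j z₀ - m i z₀ * B j‖ ≤ ‖B i‖ * ‖m j z₀‖ + ‖m i z₀‖ * ‖B j‖ := by
      simpa using norm_sub_le (B i * m j z₀) (m i z₀ * B j)
    calc ‖B i * m j z₀ - m i z₀ * B j‖ ^ 2 ≤ (‖B i‖ * ‖m j z₀‖ + ‖m i z₀‖ * ‖B j‖) ^ 2 := by gcongr
      _ ≤ (‖B i‖ ^ 2 + ‖B j‖ ^ 2) * (‖m i z₀‖ ^ 2 + ‖m j z₀‖ ^ 2) := by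
        nlinarith [sq_nonneg (‖B i‖ * ‖m i z₀‖ - ‖m j z₀‖ * ‖B j‖)]
      _ ≤ _ := by gcongr; exacts [hpair B, hpair (fun i => m i z₀)]
  rw [hwr]
  have hA0 : 0 ≤ A := by positivity
  calc _ ≤ (2 * κ * A) * A * D ^ 2 := by
        gcongr
        exact hcs.trans (by gcongr; linarith)
    _ = _ := by rw [hκ]; field_simp

/-- Five holomorphic functions, any two without common zeros, whose pairwise Wronskians are
multiples of a single function `W`, together with `F = W² / ∏ Lᵢ`. -/
structure WronskianSystem (L : Fin 5 → ℂ → ℂ) (W F : ℂ → ℂ) (c : Fin 5 → Fin 5 → ℂ) : Prop where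
  analytic (i : Fin 5) (z : ℂ) : AnalyticAt ℂ (L i) z
  analytic_W (z : ℂ) : AnalyticAt ℂ W z
  analytic_F (z : ℂ) : AnalyticAt ℂ F z
  wronskian (i j : Fin 5) (z : ℂ) : deriv (L i) z * L j z - L i z * deriv (L j) z = c i j * W z
  coeff_ne_zero {i j : Fin 5} (hij : i ≠ j) : c i j ≠ 0
  ne_zero {i j : Fin 5} (hij : i ≠ j) {z : ℂ} (hi : L i z = 0) : L j z ≠ 0
  mul_prod (z : ℂ) : F z * ∏ i, L i z = W z ^ 2

namespace WronskianSystem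

variable {L : Fin 5 → ℂ → ℂ} {W F : ℂ → ℂ} {c : Fin 5 → Fin 5 → ℂ}

/-- Each product `F * Lᵢ` has a local analytic square root where `F` does not vanish. -/
theorem exists_sq_eq (H : WronskianSystem L W F c) {z₀ : ℂ} (hF : F z₀ ≠ 0) (i : Fin 5) :
    ∃ m : ℂ → ℂ, AnalyticAt ℂ m z₀ ∧ ∀ᶠ z in 𝓝 z₀, m z ^ 2 = F z * L i z := by
  by_cases hi : L i z₀ = 0
  · have hU : AnalyticAt ℂ (fun z => ∏ k ∈ Finset.univ.erase i, L k z) z₀ :=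
      Finset.analyticAt_fun_prod _ fun k _ => H.analytic k z₀
    have hU0 : ∏ k ∈ Finset.univ.erase i, L k z₀ ≠ 0 :=
      Finset.prod_ne_zero_iff.2 fun k hk => H.ne_zero (Finset.ne_of_mem_erase hk).symm hi
    obtain ⟨s, hs, hs2⟩ := hU.exists_sq_eq hU0
    have hs0 : s z₀ ≠ 0 := fun h0 => hU0 (by rw [← hs2.self_of_nhds, h0]; simp)
    refine ⟨fun z => W z / s z, (H.analytic_W z₀).fun_div hs hs0, ?_⟩
    filter_upwards [hs2, hs.continuousAt.eventually_ne hs0] with z hz hz0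
    rw [div_pow, div_eq_iff (pow_ne_zero 2 hz0), hz, ← H.mul_prod, mul_assoc,
      Finset.mul_prod_erase _ (fun k => L k z) (Finset.mem_univ i)]
  · exact ((H.analytic_F z₀).fun_mul (H.analytic i z₀)).exists_sq_eq (mul_ne_zero hF hi)

/-- The Wronskian of local square roots of `F * Lᵢ` and `F * Lⱼ`. -/
theorem wronskian_sqrt (H : WronskianSystem L W F c) {z₀ : ℂ} (hF : F z₀ ≠ 0)
    {m : Fin 5 → ℂ → ℂ} (hm : ∀ i, AnalyticAt ℂ (m i) z₀)
    (hm2 : ∀ i, ∀ᶠ z in 𝓝 z₀, m i z ^ 2 = F z * L i z)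
    (hL : ∀ i, ∀ᶠ z in 𝓝[≠] z₀, L i z ≠ 0) {i j : Fin 5} (hij : i ≠ j) :
    4 * (deriv (m i) z₀ * m j z₀ - m i z₀ * deriv (m j) z₀) ^ 2 =
      F z₀ ^ 3 * c i j ^ 2 * ∏ k ∈ (Finset.univ.erase i).erase j, L k z₀ := by
  have hc1 : ContinuousAt (fun z => 4 * (deriv (m i) z * m j z - m i z * deriv (m j) z) ^ 2) z₀ :=
    continuousAt_const.mul ((((hm i).deriv.continuousAt.mul (hm j).continuousAt).sub
      ((hm i).continuousAt.mul (hm j).deriv.continuousAt)).pow 2)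
  have hc2 : ContinuousAt (fun z => F z ^ 3 * c i j ^ 2 *
      ∏ k ∈ (Finset.univ.erase i).erase j, L k z) z₀ :=
    (((H.analytic_F z₀).continuousAt.pow 3).mul continuousAt_const).mul
      (tendsto_finsetProd _ fun k _ => (H.analytic k z₀).continuousAt)
  refine ((hc1.eventuallyEq_nhds_iff_eventuallyEq_nhdsNE hc2).1 ?_).eq_of_nhds
  have hd (k) : ∀ᶠ z in 𝓝 z₀, 2 * (m k z * deriv (m k) z) =
      deriv F z * L k z + F z * deriv (L k) z := by
    filter_upwards [(hm2 k).eventually_nhds, (hm k).eventually_analyticAt] with z hz hmz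
    have h1 := (hmz.differentiableAt.hasDerivAt.fun_pow 2).deriv
    rw [Filter.EventuallyEq.deriv_eq hz, ((H.analytic_F z).differentiableAt.hasDerivAt.fun_mul
      (H.analytic k z).differentiableAt.hasDerivAt).deriv] at h1
    rw [h1]; push_cast; ring
  filter_upwards [hL i, hL j, nhdsWithin_le_nhds (hm2 i), nhdsWithin_le_nhds (hm2 j),
    nhdsWithin_le_nhds (hd i), nhdsWithin_le_nhds (hd j),
    nhdsWithin_le_nhds ((H.analytic_F z₀).continuousAt.eventually_ne hF)]
    with z hi hj hmi hmj hdi hdj hFz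
  have hP : L i z * (L j z * ∏ k ∈ (Finset.univ.erase i).erase j, L k z) = ∏ k, L k z := by
    rw [Finset.mul_prod_erase _ (fun k => L k z) (Finset.mem_erase.2 ⟨hij.symm, Finset.mem_univ j⟩),
      Finset.mul_prod_erase _ (fun k => L k z) (Finset.mem_univ i)]
  have hW := H.mul_prod z
  rw [← hP] at hW
  have hw := H.wronskian i j z
  set T := ∏ k ∈ (Finset.univ.erase i).erase j, L k z
  set ω := deriv (m i) z * m j z - m i z * deriv (m j) z with hω
  have h1 : 2 * (m i z * m j z) * ω = F z ^ 2 * (c i j * W z) := by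
    calc 2 * (m i z * m j z) * ω = (2 * (m i z * deriv (m i) z)) * m j z ^ 2 -
          m i z ^ 2 * (2 * (m j z * deriv (m j) z)) := by rw [hω]; ring
      _ = _ := by rw [hdi, hdj, hmi, hmj, ← hw]; ring
  have h2 : F z ^ 2 * (L i z * L j z) ≠ 0 := by positivity
  refine mul_left_cancel₀ h2 ?_
  calc F z ^ 2 * (L i z * L j z) * (4 * ω ^ 2) = (2 * (m i z * m j z) * ω) ^ 2 := by
        linear_combination (-4 * ω ^ 2 * m j z ^ 2) * hmi - 4 * ω ^ 2 * F z * L i z * hmj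
    _ = _ := by rw [h1, mul_pow, mul_pow, ← hW]; ring

/-- The metric density `‖F‖ ∑ ‖Lᵢ‖` is controlled by the hyperbolic one where their quotient is
locally maximal. -/
theorem le_of_isLocalMax (H : WronskianSystem L W F c) {C : ℝ} (hC : 0 < C)
    (hS : ∀ i j, i ≠ j → ∀ z, ∑ k, ‖L k z‖ ≤ C * max ‖L i z‖ ‖L j z‖)
    (hL : ∀ i z₀, ∀ᶠ z in 𝓝[≠] z₀, L i z ≠ 0) {p z₀ : ℂ} {R : ℝ} (hF : F z₀ ≠ 0)
    (hD : 0 < R ^ 2 - ‖z₀ - p‖ ^ 2)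
    (hmax : IsLocalMax
      (fun z => ‖F z‖ * (∑ i, ‖L i z‖) * (R ^ 2 - ‖z - p‖ ^ 2) ^ 2) z₀) :
    ‖F z₀‖ * (∑ i, ‖L i z₀‖) * (R ^ 2 - ‖z₀ - p‖ ^ 2) ^ 2 ≤
      (∑ i, ∑ j, 8 * C ^ 3 / ‖c i j‖ ^ 2) * R ^ 2 := by
  choose m hm hm2 using H.exists_sq_eq hF
  have hsum : ∀ᶠ z in 𝓝 z₀, ‖F z‖ * (∑ i, ‖L i z‖) = ∑ i, ‖m i z‖ ^ 2 := by
    filter_upwards [eventually_all.2 hm2] with z hz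
    rw [Finset.mul_sum]
    exact Finset.sum_congr rfl fun i _ => by rw [← norm_pow, hz, norm_mul]
  have hmax' : IsLocalMax
      (fun z => (∑ i, ‖m i z‖ ^ 2) * (R ^ 2 - ‖z - p‖ ^ 2) ^ 2) z₀ := by
    refine hmax.congr ?_
    filter_upwards [hsum] with z hz
    rw [hz]
  obtain ⟨i, -, hi⟩ := Finset.exists_min_image Finset.univ (fun i => ‖L i z₀‖) ⟨0, Finset.mem_univ _⟩
  obtain ⟨j, hji⟩ := exists_ne i
  have hbound := hmax'.norm_wronskian_sq_le hm hD hji.symm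
  have hω := congrArg norm (H.wronskian_sqrt hF hm hm2 (fun i => hL i z₀) hji.symm)
  rw [← hsum.self_of_nhds] at hbound
  simp only [norm_mul, norm_pow, norm_prod, RCLike.norm_ofNat] at hω
  set ω := ‖deriv (m i) z₀ * m j z₀ - m i z₀ * deriv (m j) z₀‖
  set S := ∑ i, ‖L i z₀‖ with hSdef
  set D := R ^ 2 - ‖z₀ - p‖ ^ 2
  have hk (k) (hki : k ≠ i) : S / C ≤ ‖L k z₀‖ := by
    rw [div_le_iff₀' hC]
    have := hS i k hki.symm z₀
    rwa [max_eq_right (hi k (Finset.mem_univ k))] at this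
  have hS0 : 0 < S := by
    have h0 : 0 < ‖L i z₀‖ ∨ 0 < ‖L j z₀‖ := by
      by_cases h : L i z₀ = 0
      · exact .inr (norm_pos_iff.2 (H.ne_zero hji.symm h))
      · exact .inl (norm_pos_iff.2 h)
    have h1 : ‖L i z₀‖ ≤ S := Finset.single_le_sum (f := fun i => ‖L i z₀‖)
      (fun _ _ => norm_nonneg _) (Finset.mem_univ i)
    have h2 : ‖L j z₀‖ ≤ S := Finset.single_le_sum (f := fun i => ‖L i z₀‖)
      (fun _ _ => norm_nonneg _) (Finset.mem_univ j)
    rcases h0 with h | h <;> linarith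
  have hT : (S / C) ^ 3 ≤ ∏ k ∈ (Finset.univ.erase i).erase j, ‖L k z₀‖ := by
    have hcard : ((Finset.univ.erase i).erase j).card = 3 := by
      rw [Finset.card_erase_of_mem (Finset.mem_erase.2 ⟨hji, Finset.mem_univ j⟩),
        Finset.card_erase_of_mem (Finset.mem_univ i)]
      simp
    rw [← hcard, ← Finset.prod_const]
    exact Finset.prod_le_prod (fun _ _ => by positivity) fun k hk' =>
      hk k (Finset.ne_of_mem_erase (Finset.mem_of_mem_erase hk'))
  have hF0 : 0 < ‖F z₀‖ := norm_pos_iff.2 hF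
  have hc0 : 0 < ‖c i j‖ := norm_pos_iff.2 (H.coeff_ne_zero hji.symm)
  have hone : ‖F z₀‖ * S * D ^ 2 ≤ 8 * C ^ 3 / ‖c i j‖ ^ 2 * R ^ 2 := by
    have h1 : ‖F z₀‖ ^ 3 * ‖c i j‖ ^ 2 * (S / C) ^ 3 ≤ 4 * ω ^ 2 := by
      rw [hω]; gcongr
    have h2 : ‖F z₀‖ ^ 3 * ‖c i j‖ ^ 2 * (S / C) ^ 3 * D ^ 2 ≤ 8 * R ^ 2 * (‖F z₀‖ * S) ^ 2 := by
      nlinarith [mul_le_mul_of_nonneg_right h1 (sq_nonneg D)]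
    rw [div_mul_eq_mul_div, le_div_iff₀ (by positivity)]
    refine le_of_mul_le_mul_left (a := (‖F z₀‖ * S) ^ 2 / C ^ 3) ?_ (by positivity)
    calc _ = ‖F z₀‖ ^ 3 * ‖c i j‖ ^ 2 * (S / C) ^ 3 * D ^ 2 := by field_simp
      _ ≤ _ := h2
      _ = _ := by field_simp
  refine hone.trans (mul_le_mul_of_nonneg_right ?_ (sq_nonneg R))
  calc 8 * C ^ 3 / ‖c i j‖ ^ 2 ≤ ∑ j, 8 * C ^ 3 / ‖c i j‖ ^ 2 :=
        Finset.single_le_sum (f := fun j => 8 * C ^ 3 / ‖c i j‖ ^ 2)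
          (fun _ _ => by positivity) (Finset.mem_univ j)
    _ ≤ _ := Finset.single_le_sum (f := fun i => ∑ j, 8 * C ^ 3 / ‖c i j‖ ^ 2)
          (fun _ _ => by positivity) (Finset.mem_univ i)

/-- Ahlfors–Schwarz on disks of arbitrarily large radius forces `F = 0`. -/
theorem eq_zero (H : WronskianSystem L W F c) {C : ℝ} (hC : 0 < C)
    (hS : ∀ i j, i ≠ j → ∀ z, ∑ k, ‖L k z‖ ≤ C * max ‖L i z‖ ‖L j z‖)
    (hL : ∀ i z₀, ∀ᶠ z in 𝓝[≠] z₀, L i z ≠ 0) (p : ℂ) : F p = 0 := by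
  by_contra hFp
  set K : ℝ := ∑ i, ∑ j, 8 * C ^ 3 / ‖c i j‖ ^ 2
  have hK : 0 ≤ K := by positivity
  set x : ℝ := ‖F p‖ * ∑ i, ‖L i p‖ with hx
  have hx0 : 0 < x := by
    refine mul_pos (norm_pos_iff.2 hFp) ?_
    by_contra hle
    have h0 : ∀ i, L i p = 0 := fun i => norm_le_zero_iff.1 <|
      (Finset.single_le_sum (f := fun i => ‖L i p‖) (fun _ _ => norm_nonneg _)
        (Finset.mem_univ i)).trans (not_lt.1 hle)
    exact H.ne_zero (zero_ne_one : (0 : Fin 5) ≠ 1) (h0 0) (h0 1)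
  obtain ⟨R, hR, hRK⟩ : ∃ R : ℝ, 0 < R ∧ K < x * R ^ 2 := by
    refine ⟨Real.sqrt (K / x + 1), by positivity, ?_⟩
    rw [Real.sq_sqrt (by positivity)]
    field_simp
    linarith
  set Φ : ℂ → ℝ := fun z => ‖F z‖ * (∑ i, ‖L i z‖) * (R ^ 2 - ‖z - p‖ ^ 2) ^ 2 with hΦ
  have hcont : Continuous Φ := by
    have h1 : Continuous F := continuous_iff_continuousAt.2 fun z => (H.analytic_F z).continuousAt
    have h2 (i) : Continuous (L i) :=
      continuous_iff_continuousAt.2 fun z => (H.analytic i z).continuousAt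
    fun_prop
  obtain ⟨z₀, hz₀, hmax⟩ := (isCompact_closedBall p R).exists_isMaxOn
    ⟨p, Metric.mem_closedBall_self hR.le⟩ hcont.continuousOn
  have hp : Φ p = x * R ^ 4 := by simp only [hΦ, hx, sub_self, norm_zero]; ring
  have hle : x * R ^ 4 ≤ Φ z₀ := hp ▸ hmax (Metric.mem_closedBall_self hR.le)
  have hpos : 0 < Φ z₀ := lt_of_lt_of_le (by positivity) hle
  have hF : F z₀ ≠ 0 := by rintro h; simp [hΦ, h] at hpos
  have hzR : ‖z₀ - p‖ < R := by
    refine lt_of_le_of_ne (by simpa [dist_eq_norm] using hz₀) fun h => ?_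
    simp [hΦ, h] at hpos
  have hD : 0 < R ^ 2 - ‖z₀ - p‖ ^ 2 := by nlinarith [norm_nonneg (z₀ - p)]
  have := H.le_of_isLocalMax hC hS hL hF hD
    (hmax.isLocalMax (Metric.closedBall_mem_nhds_of_mem (by simpa [dist_eq_norm] using hzR)))
  nlinarith [hle.trans this, pow_pos hR 2]

end WronskianSystem


/-- A meromorphic function `φ : ℂ → ℙ¹` whose derivative vanishes at every preimage of
each of 5 given points is constant. Here `φ` is represented by entire functions `(g, h)`
without common zeros, the 5 values `aᵢ = ((v i).1 : (v i).2) ∈ ℙ¹` are pairwise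
distinct, `φ(t) = aᵢ` means `(v i).2·g(t) = (v i).1·h(t)`, and vanishing of the
derivative of `φ` at `t` means vanishing of the Wronskian `g'h − gh'` at `t`. The
conclusion `φ` constant means `g` and `h` are linearly dependent. -/
theorem five_ramification_points_implies_constant
    (g h : ℂ → ℂ) (hg : Differentiable ℂ g) (hh : Differentiable ℂ h)
    (hnz : ∀ z : ℂ, g z ≠ 0 ∨ h z ≠ 0)
    (v : Fin 5 → ℂ × ℂ) (hv : ∀ i, v i ≠ (0, 0))
    (hdistinct : ∀ i j, i ≠ j → (v i).1 * (v j).2 ≠ (v i).2 * (v j).1)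
    (hram : ∀ (t : ℂ), (∃ i, (v i).2 * g t = (v i).1 * h t) →
      deriv g t * h t - g t * deriv h t = 0) :
    ∃ a b : ℂ, (a, b) ≠ (0, 0) ∧ ∀ z : ℂ, a * g z + b * h z = 0 := by
  set ℓ : ℂ × ℂ → ℂ → ℂ := fun u z => u.2 * g z - u.1 * h z with hℓ
  set W : ℂ → ℂ := fun z => deriv g z * h z - g z * deriv h z with hWdef
  by_contra hind
  have hℓd (u) : Differentiable ℂ (ℓ u) := (hg.const_mul _).sub (hh.const_mul _)
  have hℓa (u z) : AnalyticAt ℂ (ℓ u) z := (hℓd u).analyticAt z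
  have hne {u : ℂ × ℂ} (hu : u ≠ (0, 0)) : ℓ u ≠ 0 := by
    refine fun h0 => hind ⟨u.2, -u.1, fun h1 => hu ?_, fun z => ?_⟩
    · simp only [Prod.mk.injEq, neg_eq_zero] at h1
      exact Prod.ext h1.2 h1.1
    · have := congrFun h0 z
      simp only [hℓ, Pi.zero_apply] at this
      linear_combination this
  have htop {u : ℂ × ℂ} (hu : u ≠ (0, 0)) (z) : analyticOrderAt (ℓ u) z ≠ ⊤ := fun ht =>
    hne hu ((AnalyticOnNhd.analyticOrderAt_eq_top_iff_eq_zero z (hℓa u)).1 ht)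
  have hwr (u w : ℂ × ℂ) (z) : deriv (ℓ u) z * ℓ w z - ℓ u z * deriv (ℓ w) z =
      (u.1 * w.2 - u.2 * w.1) * W z := by
    have hd (u : ℂ × ℂ) : deriv (ℓ u) z = u.2 * deriv g z - u.1 * deriv h z :=
      (((hg z).hasDerivAt.const_mul _).sub ((hh z).hasDerivAt.const_mul _)).deriv
    rw [hd, hd]
    simp only [hℓ, hWdef]
    ring
  have hcop {i j : Fin 5} (hij : i ≠ j) {z : ℂ} (hi : ℓ (v i) z = 0) : ℓ (v j) z ≠ 0 := by
    intro hj
    simp only [hℓ] at hi hj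
    have hc := sub_ne_zero.2 (hdistinct i j hij)
    have h1 : ((v i).1 * (v j).2 - (v i).2 * (v j).1) * g z = 0 := by
      linear_combination (v i).1 * hj - (v j).1 * hi
    have h2 : ((v i).1 * (v j).2 - (v i).2 * (v j).1) * h z = 0 := by
      linear_combination (v i).2 * hj - (v j).2 * hi
    rcases hnz z with h3 | h3
    · exact mul_ne_zero hc h3 h1
    · exact mul_ne_zero hc h3 h2
  have hWa (z) : AnalyticAt ℂ W z :=
    ((hg.analyticAt z).deriv.mul (hh.analyticAt z)).sub
      ((hg.analyticAt z).mul (hh.analyticAt z).deriv)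
  have hWd : Differentiable ℂ W := fun z => (hWa z).differentiableAt
  have hord {u w : ℂ × ℂ} (hc : u.1 * w.2 - u.2 * w.1 ≠ 0) {z : ℂ} (hu : ℓ u z = 0)
      (hw : ℓ w z ≠ 0) : analyticOrderAt W z + 1 = analyticOrderAt (ℓ u) z := by
    rw [← (hℓa u z).analyticOrderAt_wronskian_add_one (hℓa w z) hu hw]
    simp only [hwr]
    congr 1
    have := analyticOrderAt_mul (analyticAt_const (v := u.1 * w.2 - u.2 * w.1) (x := z)) (hWa z)
    rw [(analyticAt_const (v := u.1 * w.2 - u.2 * w.1) (x := z)).analyticOrderAt_eq_zero.2 hc,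
      zero_add] at this
    exact this.symm
  have hQ (z) : (∀ i, ℓ (v i) z ≠ 0) ∧ analyticOrderAt (fun w => ∏ i, ℓ (v i) w) z = 0 ∨
      ∃ i, ℓ (v i) z = 0 ∧
        analyticOrderAt (fun w => ∏ i, ℓ (v i) w) z = analyticOrderAt (ℓ (v i)) z := by
    by_cases hz : ∃ i, ℓ (v i) z = 0
    · obtain ⟨i, hi⟩ := hz
      refine .inr ⟨i, hi, ?_⟩
      have hU : AnalyticAt ℂ (fun w => ∏ k ∈ Finset.univ.erase i, ℓ (v k) w) z :=
        Finset.analyticAt_fun_prod _ fun k _ => hℓa _ z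
      have hU0 := hU.analyticOrderAt_eq_zero.2
        (Finset.prod_ne_zero_iff.2 fun k hk => hcop (Finset.ne_of_mem_erase hk).symm hi)
      rw [← add_zero (analyticOrderAt (ℓ (v i)) z), ← hU0, ← analyticOrderAt_mul (hℓa _ z) hU]
      congr 1
      ext w
      exact (Finset.mul_prod_erase _ (fun k => ℓ (v k) w) (Finset.mem_univ i)).symm
    · push Not at hz
      refine .inl ⟨hz, ?_⟩
      exact (Finset.analyticAt_fun_prod _ fun k _ => hℓa _ z).analyticOrderAt_eq_zero.2
        (Finset.prod_ne_zero_iff.2 fun k _ => hz k)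
  obtain ⟨F, hFa, hF⟩ := Differentiable.exists_mul_eq_of_analyticOrderAt_le
    (P := W ^ 2) (Q := fun z => ∏ i, ℓ (v i) z) (hWd.pow 2)
    (Differentiable.fun_finsetProd fun i _ => hℓd (v i))
    (fun z => by
      rcases hQ z with ⟨-, h0⟩ | ⟨i, -, h0⟩
      · simp [h0]
      · rw [h0]; exact htop (hv i) z)
    (fun z => by
      rcases hQ z with ⟨-, h0⟩ | ⟨i, hi, h0⟩
      · simp [h0]
      · obtain ⟨j, hji⟩ := exists_ne i
        have hW0 : W z = 0 := hram z ⟨i, sub_eq_zero.1 hi⟩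
        have h1 : 1 ≤ analyticOrderAt W z :=
          Order.one_le_iff_ne_zero.2 ((hWa z).analyticOrderAt_ne_zero.2 hW0)
        rw [h0, ← hord (sub_ne_zero.2 (hdistinct i j hji.symm)) hi (hcop hji.symm hi),
          analyticOrderAt_pow (hWa z), two_nsmul]
        gcongr)
  have H : WronskianSystem (fun i => ℓ (v i)) W F
      (fun i j => (v i).1 * (v j).2 - (v i).2 * (v j).1) :=
    { analytic := fun i z => hℓa _ z
      analytic_W := hWa
      analytic_F := hFa
      wronskian := fun i j z => hwr _ _ z
      coeff_ne_zero := fun hij => sub_ne_zero.2 (hdistinct _ _ hij)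
      ne_zero := hcop
      mul_prod := hF }
  set c : Fin 5 → Fin 5 → ℂ := fun i j => (v i).1 * (v j).2 - (v i).2 * (v j).1 with hc
  set κ : Fin 5 → Fin 5 → Fin 5 → ℝ := fun i j k => (‖c k j‖ + ‖c i k‖) / ‖c i j‖ with hκ
  set C : ℝ := 1 + ∑ i, ∑ j, ∑ k, κ i j k
  have hC : 0 < C := by positivity
  have hS (i j : Fin 5) (hij : i ≠ j) (z : ℂ) :
      ∑ k, ‖ℓ (v k) z‖ ≤ C * max ‖ℓ (v i) z‖ ‖ℓ (v j) z‖ := by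
    set μ := max ‖ℓ (v i) z‖ ‖ℓ (v j) z‖
    have hμ : 0 ≤ μ := le_max_of_le_left (norm_nonneg _)
    have hcij : 0 < ‖c i j‖ := norm_pos_iff.2 (H.coeff_ne_zero hij)
    have hk (k) : ‖ℓ (v k) z‖ ≤ κ i j k * μ := by
      have h1 : c i j * ℓ (v k) z = c k j * ℓ (v i) z + c i k * ℓ (v j) z := by
        simp only [hc, hℓ]; ring
      have h2 : ‖c i j‖ * ‖ℓ (v k) z‖ ≤ ‖c k j‖ * μ + ‖c i k‖ * μ := by
        rw [← norm_mul, h1]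
        refine (norm_add_le _ _).trans ?_
        rw [norm_mul, norm_mul]
        gcongr
        exacts [le_max_left _ _, le_max_right _ _]
      rw [hκ, div_mul_eq_mul_div, le_div_iff₀ hcij]
      linarith
    refine (Finset.sum_le_sum fun k _ => hk k).trans ?_
    rw [← Finset.sum_mul]
    gcongr
    have h1 : ∑ k, κ i j k ≤ ∑ j, ∑ k, κ i j k :=
      Finset.single_le_sum (f := fun j => ∑ k, κ i j k) (fun _ _ => by positivity)
        (Finset.mem_univ j)
    have h2 : ∑ j, ∑ k, κ i j k ≤ ∑ i, ∑ j, ∑ k, κ i j k :=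
      Finset.single_le_sum (f := fun i => ∑ j, ∑ k, κ i j k) (fun _ _ => by positivity)
        (Finset.mem_univ i)
    linarith
  have hF0 := H.eq_zero hC hS fun i z => (hℓa (v i) z).eventually_eq_zero_or_eventually_ne_zero
    |>.resolve_left fun h0 => htop (hv i) z (analyticOrderAt_eq_top.2 h0)
  have hW0 : W = 0 := by
    ext z
    have := hF z
    rw [hF0, zero_mul] at this
    exact pow_eq_zero_iff two_ne_zero |>.1 this.symm
  obtain ⟨i, hi⟩ : ∃ i, ℓ (v i) 0 ≠ 0 := by
    by_contra! h0
    exact hcop (zero_ne_one : (0 : Fin 5) ≠ 1) (h0 0) (h0 1)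
  have hu : (g 0, h 0) ≠ (0, 0) := by
    rcases hnz 0 with h0 | h0 <;> simp [h0]
  have hord0 := hord (u := (g 0, h 0)) (w := v i) (z := 0)
    (by intro h0; apply hi; simp only [hℓ]; linear_combination h0)
    (by simp only [hℓ]; ring) hi
  refine htop hu 0 ?_
  rw [← hord0, hW0, show analyticOrderAt (0 : ℂ → ℂ) 0 = ⊤ from
    analyticOrderAt_eq_top.2 (by simp)]
  simp
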